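/- arXiv:1807.02165 — 2 statements merged into one kernel-verified Lean document; each statement's English description precedes it below -/
import Mathlib

section
/- Let β : ℝ² → ℝ be continuously differentiable with β(s₁,s₂) > 0 for all (s₁,s₂), and let q : ℝ² → ℝ be continuously differentiable. Define A(s₁,s₂) = β(s₁,s₂)^{−1/4} · ∫_{s₂}^{s₁} β(τ,s₂)^{1/4} q(τ,s₂) dτ. Then both partial derivatives ∂_{s₁}A and ∂_{s₂}A exist at the point (0,0) and ∂_{s₁}A(0,0) − ∂_{s₂}A(0,0) = 2 q(0,0). -/
open intervalIntegral

theorem hasDerivAt_zero_id_mul {k : ℝ → ℝ} (hk : ContinuousAt k 0) :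
    HasDerivAt (fun s => s * k s) (k 0) 0 := by
  rw [hasDerivAt_iff_tendsto_slope]
  refine (hk.tendsto.mono_left nhdsWithin_le_nhds).congr' ?_
  filter_upwards [self_mem_nhdsWithin] with s hs
  have hs0 : s ≠ 0 := hs
  simp [slope_def_field, hs0]

theorem integral_zero_eq_mul_integral_comp_mul (f : ℝ → ℝ) (s : ℝ) :
    ∫ τ in (0 : ℝ)..s, f τ = s * ∫ u in (0 : ℝ)..1, f (s * u) := by
  simp

theorem normal_derivative_amplitude_recovers_potential
    (β q : ℝ × ℝ → ℝ) (hβ : ContDiff ℝ 1 β) (hβpos : ∀ p, 0 < β p)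
    (hq : ContDiff ℝ 1 q)
    (A : ℝ × ℝ → ℝ)
    (hA : A = fun p : ℝ × ℝ =>
      β p ^ (-(1 / 4 : ℝ)) * ∫ τ in p.2..p.1, β (τ, p.2) ^ ((1 : ℝ) / 4) * q (τ, p.2)) :
    ∃ D₁ D₂ : ℝ,
      HasDerivAt (fun s : ℝ => A (s, 0)) D₁ 0 ∧
      HasDerivAt (fun s : ℝ => A (0, s)) D₂ 0 ∧
      D₁ - D₂ = 2 * q (0, 0) := by
  have hβr (r : ℝ) : Continuous fun p => β p ^ r :=
    hβ.continuous.rpow_const fun p => Or.inl (hβpos p).ne'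
  set F : ℝ × ℝ → ℝ := fun p => β p ^ ((1 : ℝ) / 4) * q p with hF
  have hFc : Continuous F := (hβr _).mul hq.continuous
  have h₁ : Continuous fun s : ℝ =>
      β (s, 0) ^ (-(1 / 4 : ℝ)) * ∫ u in (0 : ℝ)..1, F (s * u, 0) := by
    refine ((hβr _).comp (by fun_prop : Continuous fun s : ℝ => (s, (0 : ℝ)))).mul ?_
    apply continuous_parametric_intervalIntegral_of_continuous'
    exact hFc.comp (by fun_prop : Continuous fun p : ℝ × ℝ => (p.1 * p.2, (0 : ℝ)))
  have h₂ : Continuous fun s : ℝ =>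
      -(β (0, s) ^ (-(1 / 4 : ℝ)) * ∫ u in (0 : ℝ)..1, F (s * u, s)) := by
    refine (((hβr _).comp (by fun_prop : Continuous fun s : ℝ => ((0 : ℝ), s))).mul ?_).neg
    apply continuous_parametric_intervalIntegral_of_continuous'
    exact hFc.comp (by fun_prop : Continuous fun p : ℝ × ℝ => (p.1 * p.2, p.1))
  refine ⟨_, _, (hasDerivAt_zero_id_mul h₁.continuousAt).congr_of_eventuallyEq (.of_forall ?_),
    (hasDerivAt_zero_id_mul h₂.continuousAt).congr_of_eventuallyEq (.of_forall ?_), ?_⟩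
  · intro s
    have h := integral_zero_eq_mul_integral_comp_mul (fun τ => F (τ, 0)) s
    simp only [hF] at h
    simp only [hA, hF, h]
    ring
  · intro s
    have h := integral_zero_eq_mul_integral_comp_mul (fun τ => F (τ, s)) s
    simp only [hF] at h
    simp only [hA, hF, integral_symm 0 s, h]
    ring
  · have hc : β (0, 0) ^ (-(1 / 4 : ℝ)) * β (0, 0) ^ ((1 : ℝ) / 4) = 1 := by
      rw [← Real.rpow_add (hβpos _)]
      norm_num
    simp only [zero_mul, integral_const, sub_zero, one_smul, hF]
    linear_combination 2 * q (0, 0) * hc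
end

section
/- Let n ≥ 1, let ψ : ℝⁿ → ℝ be twice continuously differentiable with |∇ψ(x)|² = 1 for all x ∈ ℝⁿ, let q : ℝ × ℝⁿ → ℂ be any function, and let a₀, a₁, a₂ : ℝ × ℝⁿ → ℂ be twice continuously differentiable. Define the transport operator T(f) = 2∂_t f + 2∇ψ·∇_x f + (Δψ) f and the wave operator Q(f) = ∂_t² f − Δ_x f + q f. Assume T(a₀) = 0, i·T(a₁) = −Q(a₀), and i·T(a₂) = −Q(a₁) everywhere on ℝ × ℝⁿ. Then for every real ρ ≠ 0, the function u(t,x) = e^{iρ(t−ψ(x))} ( a₀(t,x) + ρ^{−1} a₁(t,x) + ρ^{−2} a₂(t,x) ) satisfies ∂_t²u − Δ_x u + q u = ρ^{−2} e^{iρ(t−ψ(x))} Q(a₂) everywhere on ℝ × ℝⁿ. -/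
open scoped BigOperators

/-- Time derivative `∂_t u` of a function on `ℝ × ℝⁿ`. -/
noncomputable def timeDeriv {n : ℕ} (u : ℝ × EuclideanSpace ℝ (Fin n) → ℂ) :
    ℝ × EuclideanSpace ℝ (Fin n) → ℂ :=
  fun p => deriv (fun s : ℝ => u (s, p.2)) p.1

/-- Spatial partial derivative `∂_{x_i} u` of a function on `ℝ × ℝⁿ`. -/
noncomputable def spaceDeriv {n : ℕ} (i : Fin n) (u : ℝ × EuclideanSpace ℝ (Fin n) → ℂ) :
    ℝ × EuclideanSpace ℝ (Fin n) → ℂ :=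
  fun p => fderiv ℝ (fun y => u (p.1, y)) p.2 (EuclideanSpace.single i 1)

/-- Spatial Laplacian `Δ_x u = ∑ i ∂²u/∂x_i²` of a function on `ℝ × ℝⁿ`. -/
noncomputable def spaceLaplacian {n : ℕ} (u : ℝ × EuclideanSpace ℝ (Fin n) → ℂ) :
    ℝ × EuclideanSpace ℝ (Fin n) → ℂ :=
  fun p => ∑ i, spaceDeriv i (spaceDeriv i u) p

/-- Partial derivative `∂_{x_i} ψ` of a real-valued function on `ℝⁿ`. -/
noncomputable def coordDerivR {n : ℕ} (i : Fin n) (ψ : EuclideanSpace ℝ (Fin n) → ℝ) :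
    EuclideanSpace ℝ (Fin n) → ℝ :=
  fun x => fderiv ℝ ψ x (EuclideanSpace.single i 1)

/-- The transport operator `T f = 2 ∂_t f + 2 ∇ψ·∇_x f + (Δψ) f`. -/
noncomputable def transportOp {n : ℕ} (ψ : EuclideanSpace ℝ (Fin n) → ℝ)
    (f : ℝ × EuclideanSpace ℝ (Fin n) → ℂ) : ℝ × EuclideanSpace ℝ (Fin n) → ℂ :=
  fun p => 2 * timeDeriv f p
    + 2 * ∑ i, (coordDerivR i ψ p.2 : ℂ) * spaceDeriv i f p
    + (∑ i, (coordDerivR i (coordDerivR i ψ) p.2 : ℂ)) * f p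

/-- The wave operator `Q f = ∂_t² f − Δ_x f + q f`. -/
noncomputable def waveOp {n : ℕ} (q : ℝ × EuclideanSpace ℝ (Fin n) → ℂ)
    (f : ℝ × EuclideanSpace ℝ (Fin n) → ℂ) : ℝ × EuclideanSpace ℝ (Fin n) → ℂ :=
  fun p => timeDeriv (timeDeriv f) p - spaceLaplacian f p + q p * f p

section Directional

variable {F : Type*} [NormedAddCommGroup F] [NormedSpace ℝ F]

/-- The directional derivative of `f` along the constant vector `v`. -/
noncomputable def dirDeriv (v : F) (f : F → ℂ) : F → ℂ :=
  fun p => fderiv ℝ f p v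

theorem ContDiff.dirDeriv {f : F → ℂ} (hf : ContDiff ℝ 2 f) (v : F) :
    ContDiff ℝ 1 (dirDeriv v f) :=
  (hf.fderiv_right (m := 1) (by norm_num)).clm_apply contDiff_const

theorem dirDeriv_add {f g : F → ℂ} (v : F) (hf : Differentiable ℝ f) (hg : Differentiable ℝ g) :
    dirDeriv v (fun p => f p + g p) = fun p => dirDeriv v f p + dirDeriv v g p := by
  funext p
  simp [dirDeriv, fderiv_fun_add (hf p) (hg p)]

theorem dirDeriv_const_mul {f : F → ℂ} (v : F) (c : ℂ) (hf : Differentiable ℝ f) :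
    dirDeriv v (fun p => c * f p) = fun p => c * dirDeriv v f p := by
  funext p
  simp [dirDeriv, fderiv_const_mul (hf p) c]

theorem dirDeriv_mul {f g : F → ℂ} (v : F) (hf : Differentiable ℝ f) (hg : Differentiable ℝ g) :
    dirDeriv v (fun p => f p * g p) =
      fun p => f p * dirDeriv v g p + g p * dirDeriv v f p := by
  funext p
  simp [dirDeriv, fderiv_fun_mul (hf p) (hg p)]

theorem dirDeriv_cexp_mul {φ f : F → ℂ} (v : F) (c : ℂ) (hφ : Differentiable ℝ φ)
    (hf : Differentiable ℝ f) :
    dirDeriv v (fun p => Complex.exp (c * φ p) * f p) =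
      fun p => Complex.exp (c * φ p) * (dirDeriv v f p + c * (dirDeriv v φ p * f p)) := by
  have hcφ : Differentiable ℝ fun p => c * φ p := hφ.const_mul c
  rw [dirDeriv_mul v hcφ.cexp hf]
  funext p
  have hexp : dirDeriv v (fun p => Complex.exp (c * φ p)) p =
      Complex.exp (c * φ p) * (c * dirDeriv v φ p) := by
    rw [← congrFun (dirDeriv_const_mul v c hφ) p]
    simp [dirDeriv, ((hcφ p).hasFDerivAt.cexp).fderiv]
  rw [hexp]
  ring

theorem dirDeriv_dirDeriv_cexp_mul {φ f : F → ℂ} (v : F) (c : ℂ) (hφ : ContDiff ℝ 2 φ)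
    (hf : ContDiff ℝ 2 f) (p : F) :
    dirDeriv v (dirDeriv v (fun p => Complex.exp (c * φ p) * f p)) p =
      Complex.exp (c * φ p) * (dirDeriv v (dirDeriv v f) p
        + c * (2 * (dirDeriv v φ p * dirDeriv v f p) + dirDeriv v (dirDeriv v φ) p * f p)
        + c ^ 2 * (dirDeriv v φ p) ^ 2 * f p) := by
  have dφ := hφ.differentiable two_ne_zero
  have df := hf.differentiable two_ne_zero
  have dφ' := (hφ.dirDeriv v).differentiable one_ne_zero
  have df' := (hf.dirDeriv v).differentiable one_ne_zero
  have dm : Differentiable ℝ (fun p => dirDeriv v φ p * f p) := dφ'.mul df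
  have dcm : Differentiable ℝ (fun p => c * (dirDeriv v φ p * f p)) := dm.const_mul c
  have ds : Differentiable ℝ (fun p => dirDeriv v f p + c * (dirDeriv v φ p * f p)) :=
    df'.add dcm
  rw [dirDeriv_cexp_mul v c dφ df, dirDeriv_cexp_mul v c dφ ds, dirDeriv_add v df' dcm,
    dirDeriv_const_mul v c dm, dirDeriv_mul v dφ' df]
  ring

end Directional

section SpaceTime

variable {n : ℕ}

theorem timeDeriv_eq_dirDeriv {f : ℝ × EuclideanSpace ℝ (Fin n) → ℂ} (hf : Differentiable ℝ f) :
    timeDeriv f = dirDeriv (1, 0) f := by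
  funext p
  have h : HasDerivAt (fun s : ℝ => (s, p.2)) ((1 : ℝ), (0 : EuclideanSpace ℝ (Fin n))) p.1 :=
    (hasDerivAt_id p.1).prodMk (hasDerivAt_const p.1 p.2)
  exact ((hf p).hasFDerivAt.comp_hasDerivAt p.1 h).deriv

theorem spaceDeriv_eq_dirDeriv {f : ℝ × EuclideanSpace ℝ (Fin n) → ℂ} (i : Fin n)
    (hf : Differentiable ℝ f) :
    spaceDeriv i f = dirDeriv (0, EuclideanSpace.single i 1) f := by
  funext p
  have h := (hf p).hasFDerivAt.comp p.2 (hasFDerivAt_prodMk_right (𝕜 := ℝ) p.1 p.2)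
  have h' := congrArg (fun L => L (EuclideanSpace.single i 1)) h.fderiv
  simpa [spaceDeriv, dirDeriv, Function.comp_def] using h'

theorem waveOp_eq_dirDeriv (q : ℝ × EuclideanSpace ℝ (Fin n) → ℂ)
    {f : ℝ × EuclideanSpace ℝ (Fin n) → ℂ} (hf : ContDiff ℝ 2 f)
    (p : ℝ × EuclideanSpace ℝ (Fin n)) :
    waveOp q f p = dirDeriv (1, 0) (dirDeriv (1, 0) f) p
      - ∑ i, dirDeriv (0, EuclideanSpace.single i 1)
          (dirDeriv (0, EuclideanSpace.single i 1) f) p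
      + q p * f p := by
  have df := hf.differentiable two_ne_zero
  have df' := fun v => (hf.dirDeriv v).differentiable one_ne_zero
  simp only [waveOp, spaceLaplacian, timeDeriv_eq_dirDeriv df, timeDeriv_eq_dirDeriv (df' _),
    spaceDeriv_eq_dirDeriv _ df, spaceDeriv_eq_dirDeriv _ (df' _)]

theorem waveOp_add (q : ℝ × EuclideanSpace ℝ (Fin n) → ℂ)
    {f g : ℝ × EuclideanSpace ℝ (Fin n) → ℂ} (hf : ContDiff ℝ 2 f) (hg : ContDiff ℝ 2 g)
    (p : ℝ × EuclideanSpace ℝ (Fin n)) :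
    waveOp q (fun p => f p + g p) p = waveOp q f p + waveOp q g p := by
  have d1 := fun v => dirDeriv_add v (hf.differentiable two_ne_zero)
    (hg.differentiable two_ne_zero)
  have d2 := fun v => dirDeriv_add v ((hf.dirDeriv v).differentiable one_ne_zero)
    ((hg.dirDeriv v).differentiable one_ne_zero)
  simp only [waveOp_eq_dirDeriv q (hf.add hg), waveOp_eq_dirDeriv q hf, waveOp_eq_dirDeriv q hg,
    d1, d2, Finset.sum_add_distrib]
  ring

theorem waveOp_const_mul (q : ℝ × EuclideanSpace ℝ (Fin n) → ℂ)
    {f : ℝ × EuclideanSpace ℝ (Fin n) → ℂ} (c : ℂ) (hf : ContDiff ℝ 2 f)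
    (p : ℝ × EuclideanSpace ℝ (Fin n)) :
    waveOp q (fun p => c * f p) p = c * waveOp q f p := by
  have d1 := fun v => dirDeriv_const_mul v c (hf.differentiable two_ne_zero)
  have d2 := fun v => dirDeriv_const_mul v c ((hf.dirDeriv v).differentiable one_ne_zero)
  simp only [waveOp_eq_dirDeriv q (contDiff_const.mul hf), waveOp_eq_dirDeriv q hf,
    d1, d2, ← Finset.mul_sum]
  ring

theorem dirDeriv_ofReal_comp_snd {g : EuclideanSpace ℝ (Fin n) → ℝ} (hg : Differentiable ℝ g)
    (s : ℝ) (w : EuclideanSpace ℝ (Fin n)) :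
    dirDeriv (s, w) (fun p : ℝ × EuclideanSpace ℝ (Fin n) => (g p.2 : ℂ)) =
      fun p => (fderiv ℝ g p.2 w : ℂ) := by
  funext p
  have h : HasFDerivAt (fun p : ℝ × EuclideanSpace ℝ (Fin n) => (g p.2 : ℂ))
      (Complex.ofRealCLM.comp ((fderiv ℝ g p.2).comp (ContinuousLinearMap.snd ℝ ℝ _))) p :=
    Complex.ofRealCLM.hasFDerivAt.comp p ((hg p.2).hasFDerivAt.comp p hasFDerivAt_snd)
  simp [dirDeriv, h.fderiv]

theorem dirDeriv_ofReal_fst (s : ℝ) (w : EuclideanSpace ℝ (Fin n)) :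
    dirDeriv (s, w) (fun p : ℝ × EuclideanSpace ℝ (Fin n) => (p.1 : ℂ)) = fun _ => (s : ℂ) := by
  funext p
  have h : HasFDerivAt (fun p : ℝ × EuclideanSpace ℝ (Fin n) => (p.1 : ℂ))
      (Complex.ofRealCLM.comp (ContinuousLinearMap.fst ℝ ℝ _)) p :=
    Complex.ofRealCLM.hasFDerivAt.comp p hasFDerivAt_fst
  simp [dirDeriv, h.fderiv]

theorem contDiff_phase {ψ : EuclideanSpace ℝ (Fin n) → ℝ} (hψ : ContDiff ℝ 2 ψ) :
    ContDiff ℝ 2 (fun p : ℝ × EuclideanSpace ℝ (Fin n) => (p.1 : ℂ) - ψ p.2) :=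
  (Complex.ofRealCLM.contDiff.comp contDiff_fst).sub
    (Complex.ofRealCLM.contDiff.comp (hψ.comp contDiff_snd))

theorem dirDeriv_phase {ψ : EuclideanSpace ℝ (Fin n) → ℝ} (hψ : Differentiable ℝ ψ)
    (s : ℝ) (w : EuclideanSpace ℝ (Fin n)) :
    dirDeriv (s, w) (fun p : ℝ × EuclideanSpace ℝ (Fin n) => (p.1 : ℂ) - ψ p.2) =
      fun p => (s : ℂ) + (-1) * (fderiv ℝ ψ p.2 w : ℂ) := by
  have d1 : Differentiable ℝ (fun p : ℝ × EuclideanSpace ℝ (Fin n) => (p.1 : ℂ)) :=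
    Complex.ofRealCLM.differentiable.comp differentiable_fst
  have d2 : Differentiable ℝ (fun p : ℝ × EuclideanSpace ℝ (Fin n) => (ψ p.2 : ℂ)) :=
    Complex.ofRealCLM.differentiable.comp (hψ.comp differentiable_snd)
  have h : (fun p : ℝ × EuclideanSpace ℝ (Fin n) => (p.1 : ℂ) - ψ p.2) =
      fun p => (p.1 : ℂ) + (-1) * (ψ p.2 : ℂ) := by
    funext p
    ring
  rw [h, dirDeriv_add _ d1 (d2.const_mul _), dirDeriv_const_mul _ _ d2, dirDeriv_ofReal_fst,
    dirDeriv_ofReal_comp_snd hψ]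

theorem dirDeriv_dirDeriv_phase {ψ : EuclideanSpace ℝ (Fin n) → ℝ} (hψ : ContDiff ℝ 2 ψ)
    (s : ℝ) (w : EuclideanSpace ℝ (Fin n)) :
    dirDeriv (s, w) (dirDeriv (s, w)
        (fun p : ℝ × EuclideanSpace ℝ (Fin n) => (p.1 : ℂ) - ψ p.2)) =
      fun p => -(fderiv ℝ (fun x => fderiv ℝ ψ x w) p.2 w : ℂ) := by
  have dψ' : Differentiable ℝ (fun x => fderiv ℝ ψ x w) :=
    ((hψ.fderiv_right (m := 1) (by norm_num)).clm_apply contDiff_const).differentiable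
      one_ne_zero
  have d2 : Differentiable ℝ
      (fun p : ℝ × EuclideanSpace ℝ (Fin n) => (fderiv ℝ ψ p.2 w : ℂ)) :=
    Complex.ofRealCLM.differentiable.comp (dψ'.comp differentiable_snd)
  rw [dirDeriv_phase (hψ.differentiable two_ne_zero),
    dirDeriv_add _ (differentiable_const _) (d2.const_mul _), dirDeriv_const_mul _ _ d2,
    dirDeriv_ofReal_comp_snd dψ']
  funext p
  simp [dirDeriv]

/-- If `ψ` solves the eikonal equation, then conjugating the wave operator by `e^{iρ(t - ψ)}`
gives `Q + iρT`. -/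
theorem waveOp_cexp_mul {ψ : EuclideanSpace ℝ (Fin n) → ℝ} (hψ : ContDiff ℝ 2 ψ)
    (heik : ∀ x, ∑ i, (coordDerivR i ψ x) ^ 2 = 1)
    (q : ℝ × EuclideanSpace ℝ (Fin n) → ℂ)
    {f : ℝ × EuclideanSpace ℝ (Fin n) → ℂ} (hf : ContDiff ℝ 2 f) (ρ : ℝ)
    (p : ℝ × EuclideanSpace ℝ (Fin n)) :
    waveOp q (fun p => Complex.exp (Complex.I * ρ * (p.1 - ψ p.2)) * f p) p =
      Complex.exp (Complex.I * ρ * (p.1 - ψ p.2)) *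
        (waveOp q f p + Complex.I * ρ * transportOp ψ f p) := by
  have df := hf.differentiable two_ne_zero
  have hφ := contDiff_phase hψ
  have heik' : ∑ i, (fderiv ℝ ψ p.2 (EuclideanSpace.single i 1) : ℂ) ^ 2 = 1 := by
    exact_mod_cast heik p.2
  rw [waveOp_eq_dirDeriv q ((contDiff_const.mul hφ).cexp.mul hf), waveOp_eq_dirDeriv q hf]
  simp only [dirDeriv_dirDeriv_cexp_mul _ _ hφ hf, dirDeriv_dirDeriv_phase hψ]
  simp only [dirDeriv_phase (hψ.differentiable two_ne_zero), transportOp,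
    timeDeriv_eq_dirDeriv df, spaceDeriv_eq_dirDeriv _ df]
  unfold coordDerivR
  simp only [Complex.ofReal_zero, zero_add, neg_mul, one_mul, neg_sq, mul_neg, mul_add,
    Finset.sum_add_distrib, Finset.sum_neg_distrib, ← Finset.mul_sum, ← Finset.sum_mul, heik']
  simp only [Complex.ofReal_one, map_zero, Complex.ofReal_zero, neg_zero, add_zero, one_mul,
    fderiv_fun_const, Pi.zero_apply, zero_mul, mul_zero, one_pow, mul_one,
    add_sub_add_right_eq_sub]
  ring

end SpaceTime

theorem geometric_optics_residual
    {n : ℕ} (hn : 1 ≤ n)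
    (ψ : EuclideanSpace ℝ (Fin n) → ℝ) (hψ : ContDiff ℝ 2 ψ)
    (heik : ∀ x, ∑ i, (coordDerivR i ψ x) ^ 2 = 1)
    (q : ℝ × EuclideanSpace ℝ (Fin n) → ℂ)
    (a₀ a₁ a₂ : ℝ × EuclideanSpace ℝ (Fin n) → ℂ)
    (ha₀ : ContDiff ℝ 2 a₀) (ha₁ : ContDiff ℝ 2 a₁) (ha₂ : ContDiff ℝ 2 a₂)
    (hT0 : ∀ p, transportOp ψ a₀ p = 0)
    (hT1 : ∀ p, Complex.I * transportOp ψ a₁ p = - waveOp q a₀ p)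
    (hT2 : ∀ p, Complex.I * transportOp ψ a₂ p = - waveOp q a₁ p)
    (ρ : ℝ) (hρ : ρ ≠ 0)
    (u : ℝ × EuclideanSpace ℝ (Fin n) → ℂ)
    (hu : u = fun p => Complex.exp (Complex.I * ρ * (p.1 - ψ p.2)) *
      (a₀ p + (ρ : ℂ)⁻¹ * a₁ p + ((ρ : ℂ) ^ 2)⁻¹ * a₂ p)) :
    ∀ p : ℝ × EuclideanSpace ℝ (Fin n),
      waveOp q u p =
        ((ρ : ℂ) ^ 2)⁻¹ * Complex.exp (Complex.I * ρ * (p.1 - ψ p.2)) * waveOp q a₂ p := by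
  intro p
  have hρ' : (ρ : ℂ) ≠ 0 := Complex.ofReal_ne_zero.mpr hρ
  have hE : ContDiff ℝ 2 (fun p : ℝ × EuclideanSpace ℝ (Fin n) =>
      Complex.exp (Complex.I * ρ * (p.1 - ψ p.2))) :=
    (contDiff_const.mul (contDiff_phase hψ)).cexp
  have hu' : u = fun p =>
      (Complex.exp (Complex.I * ρ * (p.1 - ψ p.2)) * a₀ p +
        (ρ : ℂ)⁻¹ * (Complex.exp (Complex.I * ρ * (p.1 - ψ p.2)) * a₁ p)) +
      ((ρ : ℂ) ^ 2)⁻¹ * (Complex.exp (Complex.I * ρ * (p.1 - ψ p.2)) * a₂ p) := by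
    rw [hu]
    funext p
    ring
  have hI₁ : Complex.I * ρ * transportOp ψ a₁ p = ρ * -waveOp q a₀ p := by
    rw [← hT1 p]
    ring
  have hI₂ : Complex.I * ρ * transportOp ψ a₂ p = ρ * -waveOp q a₁ p := by
    rw [← hT2 p]
    ring
  have h₀ := hE.mul ha₀
  have h₁ := hE.mul ha₁
  have h₂ := hE.mul ha₂
  rw [hu', waveOp_add q (h₀.add (contDiff_const.mul h₁)) (contDiff_const.mul h₂),
    waveOp_add q h₀ (contDiff_const.mul h₁), waveOp_const_mul q _ h₁, waveOp_const_mul q _ h₂,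
    waveOp_cexp_mul hψ heik q ha₀, waveOp_cexp_mul hψ heik q ha₁,
    waveOp_cexp_mul hψ heik q ha₂, hT0 p, hI₁, hI₂]
  field_simp
  ring
end
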